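/- Let r be a positive integer, X a nonempty definable subset of ℝⁿ, and f: X → ℝ a definable function. Say that f is of class C^r at a point x ∈ X if there exist an open neighborhood W of x in ℝⁿ and a C^r function g: W → ℝ with g = f on W ∩ X, and let D^r(f) be the set of points of X at which f is not of class C^r. Then dim D^r(f) < dim X. -/

import Mathlib

open FirstOrder Set Topology

namespace Paper

variable (L : FirstOrder.Language) [L.Structure ℝ]

/-- A subset of `ℝⁿ` is definable in the structure (with parameters from `ℝ`). -/
def Def (n : ℕ) (s : Set (Fin n → ℝ)) : Prop :=
  Set.Definable (Set.univ : Set ℝ) L s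

/-- A subset of `ℝ` is definable. -/
def Def1 (s : Set ℝ) : Prop := Def L 1 {x | x 0 ∈ s}

/-- The structure expands the ordered field `(ℝ, <, +, ·, 0, 1)`:
the order and the field operations (and the constants) are definable. -/
def ExpandsOrderedField : Prop :=
  Def L 2 {x | x 0 < x 1} ∧ Def L 3 {x | x 0 + x 1 = x 2} ∧
  Def L 3 {x | x 0 * x 1 = x 2} ∧ Def L 1 {x | x 0 = 0} ∧ Def L 1 {x | x 0 = 1}

/-- Local o-minimality: every definable subset of `ℝ` is, near each point, a finite
union of points and open intervals. -/
def LocallyOMinimal : Prop :=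
  ∀ X : Set ℝ, Def1 L X → ∀ a : ℝ,
    ∃ b c : ℝ, b < a ∧ a < c ∧
      ∃ (P : Finset ℝ) (J : Finset (ℝ × ℝ)),
        X ∩ Set.Ioo b c = ↑P ∪ ⋃ p ∈ J, Set.Ioo p.1 p.2

/-- First component of a point of `ℝ^(m+n) = ℝ^m × ℝ^n`. -/
def fstFun {m n : ℕ} (z : Fin (m + n) → ℝ) : Fin m → ℝ := fun i => z (Fin.castAdd n i)

/-- Second component of a point of `ℝ^(m+n) = ℝ^m × ℝ^n`. -/
def sndFun {m n : ℕ} (z : Fin (m + n) → ℝ) : Fin n → ℝ := fun j => z (Fin.natAdd m j)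

/-- The map `f : X → ℝⁿ`, `X ⊆ ℝ^m`, is definable (its graph over `X` is definable). -/
def DefMapOn (m n : ℕ) (X : Set (Fin m → ℝ)) (f : (Fin m → ℝ) → (Fin n → ℝ)) : Prop :=
  Def L (m + n) {z | fstFun z ∈ X ∧ sndFun z = f (fstFun z)}

/-- The function `f : X → ℝ`, `X ⊆ ℝ^m`, is definable. -/
def DefFunOn (m : ℕ) (X : Set (Fin m → ℝ)) (f : (Fin m → ℝ) → ℝ) : Prop :=
  DefMapOn L m 1 X fun x _ => f x

/-- `f` is of class `C^r` on `X` in the sense that near every point of `X` it agrees on `X`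
with a `C^r` map defined on an open neighborhood in the ambient space. -/
def CrMapOn (r m n : ℕ) (X : Set (Fin m → ℝ)) (f : (Fin m → ℝ) → (Fin n → ℝ)) : Prop :=
  ∀ a ∈ X, ∃ (W : Set (Fin m → ℝ)) (g : (Fin m → ℝ) → (Fin n → ℝ)),
    a ∈ W ∧ IsOpen W ∧ ContDiffOn ℝ r g W ∧ Set.EqOn f g (X ∩ W)

/-- Real-valued version of `CrMapOn`. -/
def CrFunOn (r m : ℕ) (X : Set (Fin m → ℝ)) (f : (Fin m → ℝ) → ℝ) : Prop :=
  ∀ a ∈ X, ∃ (W : Set (Fin m → ℝ)) (g : (Fin m → ℝ) → ℝ),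
    a ∈ W ∧ IsOpen W ∧ ContDiffOn ℝ r g W ∧ Set.EqOn f g (X ∩ W)

/-- A definable `C^r` map `X → ℝⁿ`. -/
def DefCrMapOn (r m n : ℕ) (X : Set (Fin m → ℝ)) (f : (Fin m → ℝ) → (Fin n → ℝ)) : Prop :=
  DefMapOn L m n X f ∧ CrMapOn r m n X f

/-- A definable `C^r` function `X → ℝ`. -/
def DefCrFunOn (r m : ℕ) (X : Set (Fin m → ℝ)) (f : (Fin m → ℝ) → ℝ) : Prop :=
  DefFunOn L m X f ∧ CrFunOn r m X f

/-- A definable `C^r` submanifold of `ℝⁿ` of dimension `d`: around every point there is a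
definable `C^r` chart of `ℝⁿ` straightening `M` to the first `d` coordinates. -/
def IsDefCrSubmanifold (r n d : ℕ) (M : Set (Fin n → ℝ)) : Prop :=
  Def L n M ∧
  ∀ a ∈ M, ∃ (U V : Set (Fin n → ℝ)) (φ ψ : (Fin n → ℝ) → (Fin n → ℝ)),
    a ∈ U ∧ IsOpen U ∧ Def L n U ∧
    (0 : Fin n → ℝ) ∈ V ∧ IsOpen V ∧ Def L n V ∧
    DefMapOn L n n U φ ∧ DefMapOn L n n V ψ ∧
    ContDiffOn ℝ r φ U ∧ ContDiffOn ℝ r ψ V ∧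
    Set.BijOn φ U V ∧ Set.InvOn ψ φ U V ∧
    φ a = 0 ∧
    φ '' (M ∩ U) = {x ∈ V | ∀ i : Fin n, d ≤ (i : ℕ) → x i = 0}

/-- The Euclidean norm on `ℝⁿ`. -/
noncomputable def eunorm {n : ℕ} (x : Fin n → ℝ) : ℝ := Real.sqrt (∑ i, x i ^ 2)

/-- Projection of `ℝⁿ` onto the `d` coordinates selected by `σ`. -/
def coordProj {n : ℕ} (d : ℕ) (σ : Fin d → Fin n) (x : Fin n → ℝ) : Fin d → ℝ :=
  fun i => x (σ i)

/-- `X ⊆ ℝⁿ` has dimension `d`: `d` is the largest integer such that some coordinate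
projection of `X` onto `ℝ^d` has nonempty interior. -/
def HasDim {n : ℕ} (X : Set (Fin n → ℝ)) (d : ℕ) : Prop :=
  (∃ σ : Fin d → Fin n, Function.Injective σ ∧ (interior (coordProj d σ '' X)).Nonempty) ∧
  ∀ (e : ℕ) (σ : Fin e → Fin n), Function.Injective σ →
    (interior (coordProj e σ '' X)).Nonempty → e ≤ d

/-- A (bounded) open box in `ℝⁿ`. -/
def IsOpenBox {n : ℕ} (B : Set (Fin n → ℝ)) : Prop :=
  ∃ a b : Fin n → ℝ, (∀ i, a i < b i) ∧ B = Set.pi Set.univ fun i => Set.Ioo (a i) (b i)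


/-- A type identified with a finite real power `ι → ℝ`. -/
class Coord (E : Type) where
  /-- the index set of the coordinates -/
  ι : Type
  fin : Finite ι
  /-- the coordinates -/
  e : E ≃ (ι → ℝ)

attribute [instance] Coord.fin

instance : Coord ℝ := ⟨Unit, inferInstance, (Equiv.funUnique Unit ℝ).symm⟩

instance (κ : Type) [Finite κ] : Coord (κ → ℝ) := ⟨κ, inferInstance, Equiv.refl _⟩

instance (E F : Type) [Coord E] [Coord F] : Coord (E × F) :=
  ⟨Coord.ι E ⊕ Coord.ι F, inferInstance,
    (Equiv.prodCongr Coord.e Coord.e).trans (Equiv.sumArrowEquivProdArrow _ _ _).symm⟩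

section Definability

variable {E F G : Type} [Coord E] [Coord F] [Coord G]

/-- A predicate on a real coordinate space is definable. -/
def DefPred (p : E → Prop) : Prop :=
  (Set.univ : Set ℝ).Definable L {v : Coord.ι E → ℝ | p (Coord.e.symm v)}

/-- A map between real coordinate spaces is definable, i.e. its graph is. -/
def DefFn (g : E → F) : Prop := DefPred L fun p : E × F => p.2 = g p.1

variable {L}

theorem DefPred.and {p q : E → Prop} (hp : DefPred L p) (hq : DefPred L q) :
    DefPred L fun x => p x ∧ q x := Set.Definable.inter hp hq

theorem DefPred.or {p q : E → Prop} (hp : DefPred L p) (hq : DefPred L q) :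
    DefPred L fun x => p x ∨ q x := Set.Definable.union hp hq

theorem DefPred.not {p : E → Prop} (hp : DefPred L p) :
    DefPred L fun x => ¬ p x := Set.Definable.compl hp

theorem DefPred.congr {p q : E → Prop} (hp : DefPred L p) (h : ∀ x, q x ↔ p x) :
    DefPred L q := by
  rwa [show q = p from funext fun x => propext (h x)]

theorem DefPred.imp {p q : E → Prop} (hp : DefPred L p) (hq : DefPred L q) :
    DefPred L fun x => p x → q x := (hp.not.or hq).congr fun _ => imp_iff_not_or

theorem DefPred.ex {p : E → F → Prop} (hp : DefPred L fun z : E × F => p z.1 z.2) :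
    DefPred L fun x => ∃ y, p x y := by
  have := Set.Definable.image_comp hp (Sum.inl : Coord.ι E → Coord.ι E ⊕ Coord.ι F)
  unfold DefPred
  convert this using 1
  ext v
  simp only [Set.mem_ofPred_eq, Set.mem_image]
  constructor
  · rintro ⟨y, hy⟩
    exact ⟨Sum.elim v (Coord.e y), by
      simpa [Coord.e, Equiv.sumArrowEquivProdArrow] using hy, rfl⟩
  · rintro ⟨w, hw, rfl⟩
    exact ⟨_, hw⟩

theorem DefPred.all {p : E → F → Prop} (hp : DefPred L fun z : E × F => p z.1 z.2) :
    DefPred L fun x => ∀ y, p x y :=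
  (DefPred.ex (p := fun x y => ¬ p x y) hp.not).not.congr fun x => by simp

theorem DefPred.allFin {κ : Type} [Finite κ] {p : κ → E → Prop} (hp : ∀ k, DefPred L (p k)) :
    DefPred L fun x => ∀ k, p k x := by
  have := Set.definable_iInter_of_finite hp
  unfold DefPred
  convert this using 1
  ext v
  simp

/-- A map each of whose coordinates is a coordinate of the argument. -/
def IsCoordMap (g : E → F) : Prop :=
  ∃ τ : Coord.ι F → Coord.ι E, ∀ x, Coord.e (g x) = Coord.e x ∘ τ

theorem DefPred.comp_coordMap {p : F → Prop} (hp : DefPred L p) {g : E → F} (hg : IsCoordMap g) :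
    DefPred L fun x => p (g x) := by
  obtain ⟨τ, hτ⟩ := hg
  have := Set.Definable.preimage_comp τ hp
  unfold DefPred
  convert this using 1
  ext v
  simp only [Set.mem_ofPred_eq, Set.mem_preimage]
  rw [← Equiv.apply_symm_apply Coord.e v, ← hτ]
  simp

theorem IsCoordMap.defFn {g : E → F} (hg : IsCoordMap g) : DefFn L g := by
  obtain ⟨τ, hτ⟩ := hg
  have : ∀ k : Coord.ι F, DefPred L fun p : E × F => Coord.e p.2 k = Coord.e p.1 (τ k) := by
    intro k
    refine ⟨Language.Term.equal (Language.Term.var (Sum.inr k))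
      (Language.Term.var (Sum.inl (τ k))), ?_⟩
    ext v
    simp [Coord.e, Equiv.sumArrowEquivProdArrow, Language.Formula.realize_equal]
  refine (DefPred.allFin this).congr fun p => ?_
  rw [← Coord.e.apply_eq_iff_eq, hτ, funext_iff]
  rfl

theorem isCoordMap_id : IsCoordMap (fun x : E => x) := ⟨id, fun _ => rfl⟩
theorem IsCoordMap.fst {g : E → F × G} (hg : IsCoordMap g) : IsCoordMap fun x => (g x).1 := by
  obtain ⟨τ, hτ⟩ := hg
  exact ⟨τ ∘ Sum.inl, fun x => by
    rw [← Function.comp_assoc, ← hτ]; ext; simp [Coord.e, Equiv.sumArrowEquivProdArrow]⟩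
theorem IsCoordMap.snd {g : E → F × G} (hg : IsCoordMap g) : IsCoordMap fun x => (g x).2 := by
  obtain ⟨τ, hτ⟩ := hg
  exact ⟨τ ∘ Sum.inr, fun x => by
    rw [← Function.comp_assoc, ← hτ]; ext; simp [Coord.e, Equiv.sumArrowEquivProdArrow]⟩
theorem IsCoordMap.pair {g : E → F} {h : E → G} (hg : IsCoordMap g) (hh : IsCoordMap h) :
    IsCoordMap fun x => (g x, h x) := by
  obtain ⟨τ, hτ⟩ := hg
  obtain ⟨ρ, hρ⟩ := hh
  refine ⟨Sum.elim τ ρ, fun x => ?_⟩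
  ext (k | k)
  · exact congrFun (hτ x) k
  · exact congrFun (hρ x) k
theorem IsCoordMap.eval {κ : Type} [Finite κ] {g : E → κ → ℝ} (hg : IsCoordMap g) (k : κ) :
    IsCoordMap fun x => g x k := by
  obtain ⟨τ, hτ⟩ := hg
  exact ⟨fun _ => τ k, fun x => by ext; exact congrFun (hτ x) k⟩
theorem isCoordMap_fst : IsCoordMap (fun x : E × F => x.1) := isCoordMap_id.fst
theorem isCoordMap_snd : IsCoordMap (fun x : E × F => x.2) := isCoordMap_id.snd

theorem DefFn.id : DefFn L (fun x : E => x) := isCoordMap_id.defFn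

theorem DefPred.comp {p : F → Prop} (hp : DefPred L p) {g : E → F} (hg : DefFn L g) :
    DefPred L fun x => p (g x) :=
  (DefPred.ex (p := fun x y => y = g x ∧ p y)
    (DefPred.and hg (hp.comp_coordMap isCoordMap_snd))).congr fun x => by simp

theorem DefFn.pair {g : E → F} {h : E → G} (hg : DefFn L g) (hh : DefFn L h) :
    DefFn L fun x => (g x, h x) :=
  ((hg.comp_coordMap (g := fun p : E × (F × G) => (p.1, p.2.1))
      (isCoordMap_fst.pair isCoordMap_snd.fst)).and
    (hh.comp_coordMap (g := fun p : E × (F × G) => (p.1, p.2.2))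
      (isCoordMap_fst.pair isCoordMap_snd.snd))).congr fun _ => Prod.ext_iff

theorem DefFn.comp {g : F → G} {h : E → F} (hg : DefFn L g) (hh : DefFn L h) :
    DefFn L fun x => g (h x) := by
  have h1 : DefFn L fun p : E × G => h p.1 :=
    DefPred.comp_coordMap hh (g := fun q : (E × G) × F => (q.1.1, q.2))
      (isCoordMap_fst.fst.pair isCoordMap_snd)
  exact DefPred.comp hg (h1.pair isCoordMap_snd.defFn)

theorem DefFn.fst {g : E → F × G} (hg : DefFn L g) : DefFn L fun x => (g x).1 :=
  isCoordMap_fst.defFn.comp hg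
theorem DefFn.snd {g : E → F × G} (hg : DefFn L g) : DefFn L fun x => (g x).2 :=
  isCoordMap_snd.defFn.comp hg
theorem DefFn.eval {κ : Type} [Finite κ] {g : E → κ → ℝ} (hg : DefFn L g) (k : κ) :
    DefFn L fun x => g x k :=
  (isCoordMap_id.eval k).defFn.comp hg

theorem DefFn.eq {g h : E → F} (hg : DefFn L g) (hh : DefFn L h) :
    DefPred L fun x => g x = h x :=
  (DefPred.comp hh (DefFn.id.pair hg))

theorem DefFn.pi {κ : Type} [Finite κ] {g : E → κ → ℝ} (hg : ∀ k, DefFn L fun x => g x k) :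
    DefFn L g :=
  (DefPred.allFin fun k => ((isCoordMap_snd.eval k).defFn (E := E × (κ → ℝ))).eq
    ((hg k).comp isCoordMap_fst.defFn)).congr fun _ => funext_iff

theorem DefFn.const (c : F) : DefFn L fun _ : E => c := by
  have : ∀ k : Coord.ι F, DefPred L fun p : E × F => Coord.e p.2 k = Coord.e c k := by
    intro k
    refine ⟨Language.Term.equal (Language.Term.var (Sum.inr k))
      (Language.Constants.term (L.con (⟨Coord.e c k, Set.mem_univ _⟩ : (Set.univ : Set ℝ)))), ?_⟩
    ext v
    simp [Coord.e, Equiv.sumArrowEquivProdArrow, Language.Formula.realize_equal]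
  refine (DefPred.allFin this).congr fun p => ?_
  rw [← Coord.e.apply_eq_iff_eq, funext_iff]

theorem DefFn.lt (hfield : ExpandsOrderedField L) {g h : E → ℝ} (hg : DefFn L g)
    (hh : DefFn L h) : DefPred L fun x => g x < h x := by
  have h0 : DefPred L fun z : Fin 2 → ℝ => z 0 < z 1 := hfield.1
  refine h0.comp (g := fun x => ![g x, h x]) (DefFn.pi fun k => ?_)
  fin_cases k
  · exact hg
  · exact hh

theorem DefFn.add (hfield : ExpandsOrderedField L) {g h : E → ℝ} (hg : DefFn L g)
    (hh : DefFn L h) : DefFn L fun x => g x + h x := by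
  have h0 : DefPred L fun z : Fin 3 → ℝ => z 0 + z 1 = z 2 := hfield.2.1
  refine (h0.comp (g := fun p : E × ℝ => ![g p.1, h p.1, p.2]) (DefFn.pi fun k => ?_)).congr
    fun _ => eq_comm
  fin_cases k
  · exact hg.comp DefFn.id.fst
  · exact hh.comp DefFn.id.fst
  · exact DefFn.id.snd

theorem DefFn.mul (hfield : ExpandsOrderedField L) {g h : E → ℝ} (hg : DefFn L g)
    (hh : DefFn L h) : DefFn L fun x => g x * h x := by
  have h0 : DefPred L fun z : Fin 3 → ℝ => z 0 * z 1 = z 2 := hfield.2.2.1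
  refine (h0.comp (g := fun p : E × ℝ => ![g p.1, h p.1, p.2]) (DefFn.pi fun k => ?_)).congr
    fun _ => eq_comm
  fin_cases k
  · exact hg.comp DefFn.id.fst
  · exact hh.comp DefFn.id.fst
  · exact DefFn.id.snd

theorem DefFn.sub (hfield : ExpandsOrderedField L) {g h : E → ℝ} (hg : DefFn L g)
    (hh : DefFn L h) : DefFn L fun x => g x - h x :=
  (hg.add hfield ((DefFn.const (-1 : ℝ)).mul hfield hh)).congr fun _ => by
    simp only [neg_one_mul, sub_eq_add_neg]

theorem DefFn.le (hfield : ExpandsOrderedField L) {g h : E → ℝ} (hg : DefFn L g)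
    (hh : DefFn L h) : DefPred L fun x => g x ≤ h x :=
  (hh.lt hfield hg).not.congr fun _ => not_lt.symm

end Definability

variable {L}

section Topological

variable {E F : Type} [Coord E] [Coord F]

theorem DefFn.ite {p : E → Prop} (hp : DefPred L p) {g h : E → F} (hg : DefFn L g)
    (hh : DefFn L h) [∀ x, Decidable (p x)] : DefFn L fun x => if p x then g x else h x := by
  have hp' : DefPred L fun z : E × F => p z.1 := hp.comp DefFn.id.fst
  refine ((hp'.and hg).or (hp'.not.and hh)).congr fun z => ?_
  by_cases h : p z.1 <;> simp [h]

theorem DefFn.abs (hfield : ExpandsOrderedField L) {g : E → ℝ} (hg : DefFn L g) :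
    DefFn L fun x => |g x| := by
  classical
  have := DefFn.ite ((DefFn.const (0 : ℝ)).le hfield hg) hg
    ((DefFn.const (0 : ℝ)).sub hfield hg)
  convert this using 2 with x
  split_ifs with h
  · exact abs_of_nonneg h
  · rw [abs_of_neg (not_le.1 h), zero_sub]

theorem DefPred.forall_pos (hfield : ExpandsOrderedField L) {p : E → ℝ → Prop}
    (hp : DefPred L fun z : E × ℝ => p z.1 z.2) : DefPred L fun x => ∀ ε > 0, p x ε :=
  DefPred.all (p := fun x ε => ε > 0 → p x ε)
    (((DefFn.const (0 : ℝ)).lt hfield DefFn.id.snd).imp hp)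

theorem DefPred.exists_pos (hfield : ExpandsOrderedField L) {p : E → ℝ → Prop}
    (hp : DefPred L fun z : E × ℝ => p z.1 z.2) : DefPred L fun x => ∃ ε > 0, p x ε :=
  DefPred.ex (p := fun x ε => ε > 0 ∧ p x ε)
    (((DefFn.const (0 : ℝ)).lt hfield DefFn.id.snd).and hp)

theorem DefPred.eventually_nhds_real (hfield : ExpandsOrderedField L) {p : E → ℝ → Prop}
    (hp : DefPred L fun z : E × ℝ => p z.1 z.2) {g : E → ℝ} (hg : DefFn L g) :
    DefPred L fun x => ∀ᶠ y in 𝓝 (g x), p x y := by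
  refine (DefPred.exists_pos hfield (p := fun x ε => ∀ y, |y - g x| < ε → p x y)
    (DefPred.all (p := fun (z : E × ℝ) y => |y - g z.1| < z.2 → p z.1 y) ?_)).congr fun x => ?_
  · exact (((DefFn.id.snd.sub hfield (hg.comp DefFn.id.fst.fst)).abs hfield).lt hfield
      DefFn.id.fst.snd).imp (hp.comp (DefFn.id.fst.fst.pair DefFn.id.snd))
  · simp [Metric.eventually_nhds_iff, Real.dist_eq]

theorem DefPred.eventually_nhds (hfield : ExpandsOrderedField L) {κ : Type} [Fintype κ]
    {p : E → (κ → ℝ) → Prop}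
    (hp : DefPred L fun z : E × (κ → ℝ) => p z.1 z.2) {g : E → κ → ℝ} (hg : DefFn L g) :
    DefPred L fun x => ∀ᶠ y in 𝓝 (g x), p x y := by
  refine (DefPred.exists_pos hfield (p := fun x ε => ∀ y, (∀ i, |y i - g x i| < ε) → p x y)
    (DefPred.all (p := fun (z : E × ℝ) y => (∀ i, |y i - g z.1 i| < z.2) → p z.1 y) ?_)).congr
      fun x => ?_
  · exact (DefPred.allFin fun i => (((DefFn.id.snd.eval i).sub hfield
      ((hg.comp DefFn.id.fst.fst).eval i)).abs hfield).lt hfield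
      DefFn.id.fst.snd).imp (hp.comp (DefFn.id.fst.fst.pair DefFn.id.snd))
  · rw [Metric.eventually_nhds_iff]
    refine exists_congr fun ε => and_congr_right fun hε => forall_congr' fun y => ?_
    rw [dist_pi_lt_iff hε]
    simp [Real.dist_eq]

theorem DefPred.mem_interior (hfield : ExpandsOrderedField L) {κ : Type} [Fintype κ]
    {s : Set (κ → ℝ)} (hs : DefPred L fun x => x ∈ s) : DefPred L fun x => x ∈ interior s :=
  (DefPred.eventually_nhds hfield (p := fun _ y => y ∈ s) (hs.comp DefFn.id.snd)
    DefFn.id).congr fun _ => mem_interior_iff_mem_nhds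

theorem DefFn.defPred_continuousAt (hfield : ExpandsOrderedField L) {κ : Type} [Fintype κ]
    {f : (κ → ℝ) → ℝ} (hf : DefFn L f) : DefPred L fun x => ContinuousAt f x := by
  refine (DefPred.forall_pos hfield (p := fun x ε => ∀ᶠ y in 𝓝 x, |f y - f x| < ε)
    (DefPred.eventually_nhds hfield (g := fun z : (κ → ℝ) × ℝ => z.1)
      (p := fun z y => |f y - f z.1| < z.2) ?_ DefFn.id.fst)).congr fun x => ?_
  · exact (((hf.comp DefFn.id.snd).sub hfield (hf.comp DefFn.id.fst.fst)).abs hfield).lt hfield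
      DefFn.id.fst.snd
  · simp [ContinuousAt, Metric.tendsto_nhds, Real.dist_eq]

theorem DefFn.update {κ : Type} [Fintype κ] [DecidableEq κ] {g : E → κ → ℝ} (hg : DefFn L g)
    (i : κ) {h : E → ℝ} (hh : DefFn L h) : DefFn L fun x => Function.update (g x) i (h x) := by
  refine DefFn.pi fun k => ?_
  by_cases hk : k = i
  · subst hk
    simpa using hh
  · simpa [Function.update_of_ne hk] using hg.eval k

theorem DefFn.defPred_hasDerivAt_update (hfield : ExpandsOrderedField L) {κ : Type} [Fintype κ]
    [DecidableEq κ] {f : (κ → ℝ) → ℝ} (hf : DefFn L f) (i : κ) :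
    DefPred L fun z : (κ → ℝ) × ℝ =>
      HasDerivAt (fun t => f (Function.update z.1 i t)) z.2 (z.1 i) := by
  refine (DefPred.forall_pos hfield (p := fun (z : (κ → ℝ) × ℝ) ε => ∀ᶠ t in 𝓝 (z.1 i),
    |f (Function.update z.1 i t) - f (Function.update z.1 i (z.1 i)) - (t - z.1 i) * z.2| ≤
      ε * |t - z.1 i|)
    (DefPred.eventually_nhds_real hfield (g := fun w : ((κ → ℝ) × ℝ) × ℝ => w.1.1 i)
      (p := fun w t => |f (Function.update w.1.1 i t) - f (Function.update w.1.1 i (w.1.1 i)) -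
        (t - w.1.1 i) * w.1.2| ≤ w.2 * |t - w.1.1 i|) ?_ (DefFn.id.fst.fst.eval i))).congr
      fun z => ?_
  · have h1 : DefFn L fun q : (((κ → ℝ) × ℝ) × ℝ) × ℝ => q.2 - q.1.1.1 i :=
      DefFn.id.snd.sub hfield (DefFn.id.fst.fst.fst.eval i)
    refine DefFn.le hfield (DefFn.abs hfield (DefFn.sub hfield (DefFn.sub hfield
      (hf.comp (DefFn.id.fst.fst.fst.update i DefFn.id.snd))
      (hf.comp (DefFn.id.fst.fst.fst.update i (DefFn.id.fst.fst.fst.eval i))))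
      (h1.mul hfield DefFn.id.fst.fst.snd))) (DefFn.id.fst.snd.mul hfield (h1.abs hfield))
  · simp only [hasDerivAt_iff_isLittleO, Asymptotics.isLittleO_iff, Real.norm_eq_abs,
      smul_eq_mul, gt_iff_lt]

/-- The partial derivative in the `i`-th coordinate (zero where it does not exist). -/
noncomputable def partialDeriv {κ : Type} [DecidableEq κ] (f : (κ → ℝ) → ℝ) (i : κ)
    (x : κ → ℝ) : ℝ := deriv (fun t => f (Function.update x i t)) (x i)

theorem DefFn.defPred_differentiableAt_update (hfield : ExpandsOrderedField L) {κ : Type}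
    [Fintype κ] [DecidableEq κ] {f : (κ → ℝ) → ℝ} (hf : DefFn L f) (i : κ) :
    DefPred L fun x : κ → ℝ => DifferentiableAt ℝ (fun t => f (Function.update x i t)) (x i) :=
  (DefPred.ex (p := fun (x : κ → ℝ) (y : ℝ) =>
    HasDerivAt (fun t => f (Function.update x i t)) y (x i))
    (hf.defPred_hasDerivAt_update hfield i)).congr fun _ =>
      ⟨fun h => ⟨_, h.hasDerivAt⟩, fun ⟨_, h⟩ => h.differentiableAt⟩

theorem DefFn.partialDeriv (hfield : ExpandsOrderedField L) {κ : Type} [Fintype κ]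
    [DecidableEq κ] {f : (κ → ℝ) → ℝ} (hf : DefFn L f) (i : κ) :
    DefFn L (partialDeriv f i) := by
  refine ((hf.defPred_hasDerivAt_update hfield i).or
    (((hf.defPred_differentiableAt_update hfield i).comp DefFn.id.fst).not.and
      (DefFn.id.snd.eq (DefFn.const (0 : ℝ))))).congr fun z => ?_
  constructor
  · intro h
    by_cases hd : DifferentiableAt ℝ (fun t => f (Function.update z.1 i t)) (z.1 i)
    · left
      rw [h]
      exact hd.hasDerivAt
    · exact Or.inr ⟨hd, by rw [h]; exact deriv_zero_of_not_differentiableAt hd⟩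
  · rintro (h | ⟨h, h'⟩)
    · exact h.deriv.symm
    · rw [h']
      exact (deriv_zero_of_not_differentiableAt h).symm

end Topological

section Thin

theorem LocallyOMinimal.exists_inter_Ioo (hlom : LocallyOMinimal L) {p : ℝ → Prop}
    (hp : DefPred L p) (a : ℝ) : ∃ b c : ℝ, b < a ∧ a < c ∧
      ∃ (P : Finset ℝ) (J : Finset (ℝ × ℝ)),
        {x | p x} ∩ Set.Ioo b c = ↑P ∪ ⋃ p ∈ J, Set.Ioo p.1 p.2 := by
  refine hlom {x | p x} ?_ a
  exact hp.comp (g := fun x : Fin 1 → ℝ => x 0) (DefFn.id.eval 0)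

theorem LocallyOMinimal.eventually_nhdsGT (hlom : LocallyOMinimal L) {p : ℝ → Prop}
    (hp : DefPred L p) (a : ℝ) : (∀ᶠ t in 𝓝[>] a, p t) ∨ ∀ᶠ t in 𝓝[>] a, ¬ p t := by
  obtain ⟨b, c, hb, hc, P, J, h⟩ := hlom.exists_inter_Ioo hp a
  have hbc : ∀ᶠ t in 𝓝[>] a, t ∈ Set.Ioo b c :=
    nhdsWithin_le_nhds (Ioo_mem_nhds hb hc)
  by_cases hJ : ∃ j ∈ J, j.1 ≤ a ∧ a < j.2
  · obtain ⟨j, hj, h1, h2⟩ := hJ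
    left
    filter_upwards [Ioo_mem_nhdsGT h2] with t ht
    have : t ∈ {x | p x} ∩ Set.Ioo b c := by
      rw [h]
      exact Or.inr (Set.mem_biUnion hj ⟨h1.trans_lt ht.1, ht.2⟩)
    exact this.1
  · right
    push Not at hJ
    have hP : ∀ᶠ t in 𝓝[>] a, ∀ x ∈ P, t ≠ x := by
      rw [Filter.eventually_all_finset]
      intro x _
      rcases le_or_gt x a with hx | hx
      · filter_upwards [self_mem_nhdsWithin] with t ht
        exact (hx.trans_lt ht).ne'
      · filter_upwards [Ioo_mem_nhdsGT hx] with t ht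
        exact ht.2.ne
    have hJ' : ∀ᶠ t in 𝓝[>] a, ∀ j ∈ J, t ∉ Set.Ioo j.1 j.2 := by
      rw [Filter.eventually_all_finset]
      intro j hj
      rcases le_or_gt j.1 a with hx | hx
      · filter_upwards [self_mem_nhdsWithin] with t ht h'
        exact absurd (h'.2.trans_le (hJ j hj hx)) (not_lt.2 (le_of_lt ht))
      · filter_upwards [Ioo_mem_nhdsGT hx] with t ht h'
        exact absurd h'.1 (not_lt.2 ht.2.le)
    filter_upwards [hbc, hP, hJ'] with t h1 h2 h3 h4
    have : t ∈ {x | p x} ∩ Set.Ioo b c := ⟨h4, h1⟩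
    rw [h] at this
    rcases this with h5 | h5
    · exact h2 t h5 rfl
    · obtain ⟨j, hj, h6⟩ := Set.mem_iUnion₂.1 h5
      exact h3 j hj h6

theorem LocallyOMinimal.finite_inter_Ioo (hlom : LocallyOMinimal L) {s : Set ℝ}
    (hs : DefPred L fun x => x ∈ s) (hi : interior s = ∅) (a : ℝ) :
    ∃ b c : ℝ, b < a ∧ a < c ∧ (s ∩ Set.Ioo b c).Finite := by
  obtain ⟨b, c, hb, hc, P, J, h⟩ := hlom.exists_inter_Ioo hs a
  refine ⟨b, c, hb, hc, P.finite_toSet.subset ?_⟩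
  change {x | x ∈ s} ∩ _ ⊆ _
  rw [h]
  refine Set.union_subset le_rfl (Set.iUnion₂_subset fun j hj => ?_)
  have : Set.Ioo j.1 j.2 ⊆ interior s := by
    refine interior_maximal (fun x hx => ?_) isOpen_Ioo
    have : x ∈ {x | x ∈ s} ∩ Set.Ioo b c := h ▸ Or.inr (Set.mem_biUnion hj hx)
    exact this.1
  rw [hi] at this
  exact this.trans (Set.empty_subset _)

theorem LocallyOMinimal.countable (hlom : LocallyOMinimal L) {s : Set ℝ}
    (hs : DefPred L fun x => x ∈ s) (hi : interior s = ∅) : s.Countable := by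
  have : s ⊆ ⋃ (q : ℚ × ℚ) (_ : (s ∩ Set.Ioo (q.1 : ℝ) q.2).Finite),
      s ∩ Set.Ioo (q.1 : ℝ) q.2 := by
    intro a ha
    obtain ⟨b, c, hb, hc, h⟩ := hlom.finite_inter_Ioo hs hi a
    obtain ⟨q, hq, hq'⟩ := exists_rat_btwn hb
    obtain ⟨r, hr, hr'⟩ := exists_rat_btwn hc
    refine Set.mem_iUnion₂.2 ⟨(q, r), h.subset ?_, ha, hq', hr⟩
    exact Set.inter_subset_inter_right _ (Set.Ioo_subset_Ioo hq.le hr'.le)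
  refine Set.Countable.mono this (Set.countable_iUnion fun q => Set.countable_iUnion fun h =>
    h.countable)

theorem LocallyOMinimal.not_Ioo_subset_iUnion (hlom : LocallyOMinimal L) {ι : Type} [Countable ι]
    {s : ι → Set ℝ} (hs : ∀ i, DefPred L fun x => x ∈ s i) (hi : ∀ i, interior (s i) = ∅)
    {a b : ℝ} (hab : a < b) : ¬ Set.Ioo a b ⊆ ⋃ i, s i := by
  intro h
  have := (Set.countable_iUnion fun i => hlom.countable (hs i) (hi i)).mono h
  rw [Cardinal.Real.Ioo_countable_iff] at this
  exact absurd hab (not_lt.2 this)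

theorem exists_rat_Ioo_subset {s : Set ℝ} (hs : (interior s).Nonempty) :
    ∃ q r : ℚ, q < r ∧ Set.Ioo (q : ℝ) r ⊆ s := by
  obtain ⟨x, hx⟩ := hs
  obtain ⟨b, c, hbc, h⟩ := mem_nhds_iff_exists_Ioo_subset.1 (mem_interior_iff_mem_nhds.1 hx)
  obtain ⟨q, hq, hq'⟩ := exists_rat_btwn hbc.1
  obtain ⟨r, hr, hr'⟩ := exists_rat_btwn hbc.2
  exact ⟨q, r, by exact_mod_cast hq'.trans hr,
    (Set.Ioo_subset_Ioo hq.le hr'.le).trans h⟩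

theorem interior_nonempty_of_fibers {d : ℕ} {A : Set (Fin (d + 1) → ℝ)} {V : Set (Fin d → ℝ)}
    (hV : (interior V).Nonempty) {a b : ℝ} (hab : a < b)
    (h : ∀ x ∈ V, ∀ t, a < t → t < b → (Fin.cons t x : Fin (d + 1) → ℝ) ∈ A) :
    (interior A).Nonempty := by
  obtain ⟨x, hx⟩ := hV
  obtain ⟨t, ht⟩ := exists_between hab
  let U : Set (Fin (d + 1) → ℝ) := {z | Fin.tail z ∈ interior V ∧ z 0 ∈ Set.Ioo a b}
  have hU : IsOpen U := by
    refine IsOpen.and (isOpen_interior.preimage ?_) (isOpen_Ioo.preimage (continuous_apply 0))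
    exact continuous_pi fun i => continuous_apply _
  refine ⟨Fin.cons t x, interior_maximal (fun z hz => ?_) hU ⟨by simpa using hx, by simpa using ht⟩⟩
  have := h _ (interior_subset hz.1) _ hz.2.1 hz.2.2
  rwa [Fin.cons_self_tail] at this

theorem DefFn.cons {E : Type} [Coord E] {d : ℕ} {g : E → ℝ} (hg : DefFn L g)
    {h : E → Fin d → ℝ} (hh : DefFn L h) :
    DefFn L fun x => (Fin.cons (g x) (h x) : Fin (d + 1) → ℝ) := by
  refine DefFn.pi fun k => ?_
  refine Fin.cases ?_ (fun k => ?_) k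
  · simpa using hg
  · simpa using hh.eval k

theorem LocallyOMinimal.interior_iUnion_eq_empty (hfield : ExpandsOrderedField L)
    (hlom : LocallyOMinimal L) : ∀ (d : ℕ) {ι : Type} [Countable ι] {A : ι → Set (Fin d → ℝ)},
    (∀ i, DefPred L fun x => x ∈ A i) → (∀ i, interior (A i) = ∅) →
    interior (⋃ i, A i) = ∅
  | 0, ι, _, A, _, hi => by
    simp only [interior_eq_iff_isOpen.2 (isOpen_discrete _)] at hi ⊢
    simp [hi]
  | d + 1, ι, _, A, hA, hi => by
    by_contra hne
    obtain ⟨z, hz⟩ := Set.nonempty_iff_ne_empty.2 hne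
    let B : ι × {q : ℚ × ℚ // q.1 < q.2} → Set (Fin d → ℝ) := fun k =>
      {x | ∀ t : ℝ, (k.2.1.1 : ℝ) < t → t < k.2.1.2 → (Fin.cons t x : Fin (d + 1) → ℝ) ∈ A k.1}
    have hB : interior (⋃ k, B k) = ∅ := by
      refine hlom.interior_iUnion_eq_empty hfield d (fun k => ?_) fun k => ?_
      · refine DefPred.all (p := fun (x : Fin d → ℝ) (t : ℝ) => (k.2.1.1 : ℝ) < t →
          t < k.2.1.2 → (Fin.cons t x : Fin (d + 1) → ℝ) ∈ A k.1) ?_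
        exact ((DefFn.const _).lt hfield DefFn.id.snd).imp
          ((DefFn.id.snd.lt hfield (DefFn.const _)).imp
            ((hA k.1).comp (DefFn.id.snd.cons DefFn.id.fst)))
      · by_contra h
        have := interior_nonempty_of_fibers (A := A k.1) (Set.nonempty_iff_ne_empty.2 h)
          (Rat.cast_lt (K := ℝ).2 k.2.2) fun x hx => hx
        exact this.ne_empty (hi k.1)
    have hz' : ∀ᶠ w in 𝓝 (z 0) ×ˢ 𝓝 (Fin.tail z),
        (Fin.cons w.1 w.2 : Fin (d + 1) → ℝ) ∈ ⋃ i, A i := by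
      rw [← nhds_prod_eq]
      have hc : Continuous fun w : ℝ × (Fin d → ℝ) => (Fin.cons w.1 w.2 : Fin (d + 1) → ℝ) := by
        refine continuous_pi fun k => Fin.cases ?_ (fun k => ?_) k
        · simpa using continuous_fst
        · simp only [Fin.cons_succ]
          fun_prop
      refine hc.continuousAt.eventually_mem ?_
      rw [Fin.cons_self_tail]
      exact mem_interior_iff_mem_nhds.1 hz
    obtain ⟨I, hI, V, hV, hIV⟩ := Filter.eventually_prod_iff.1 hz'
    obtain ⟨a, b, hab, hab'⟩ := mem_nhds_iff_exists_Ioo_subset.1 hI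
    have : ¬ {x | V x} ⊆ ⋃ k, B k := fun h => by
      have := mem_interior_iff_mem_nhds.2 (Filter.mem_of_superset hV h)
      rw [hB] at this
      exact this
    obtain ⟨x, hx, hxB⟩ := Set.not_subset.1 this
    refine hlom.not_Ioo_subset_iUnion
      (s := fun i => {t | (Fin.cons t x : Fin (d + 1) → ℝ) ∈ A i}) (fun i => ?_) (fun i => ?_)
      (hab.1.trans hab.2) fun t ht => ?_
    · exact (hA i).comp (DefFn.id.cons (DefFn.const x))
    · by_contra h
      obtain ⟨q, r, hqr, h⟩ := exists_rat_Ioo_subset (Set.nonempty_iff_ne_empty.2 h)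
      exact hxB (Set.mem_iUnion.2 ⟨(i, ⟨(q, r), hqr⟩), fun t h1 h2 => h ⟨h1, h2⟩⟩)
    · simpa using hIV (hab' ht) hx

theorem interior_self_sdiff_interior {X : Type*} [TopologicalSpace X] (s : Set X) :
    interior (s \ interior s) = ∅ := by
  refine Set.eq_empty_of_forall_notMem fun x hx => (interior_subset hx).2 ?_
  exact interior_mono Set.sdiff_subset hx

theorem LocallyOMinimal.isNowhereDense (hfield : ExpandsOrderedField L)
    (hlom : LocallyOMinimal L) {d : ℕ} {A : Set (Fin d → ℝ)} (hA : DefPred L fun x => x ∈ A)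
    (hi : interior A = ∅) : IsNowhereDense A := by
  have := hlom.interior_iUnion_eq_empty hfield d
    (A := fun b : Bool => cond b A (Aᶜ \ interior Aᶜ)) ?_ ?_
  · refine Set.subset_empty_iff.1 (this ▸ interior_mono fun x hx => ?_)
    by_cases h : x ∈ A
    · exact Set.mem_iUnion.2 ⟨true, h⟩
    · exact Set.mem_iUnion.2 ⟨false, h, by simpa [interior_compl] using hx⟩
  · rintro (_ | _)
    · exact hA.not.and (DefPred.mem_interior hfield (s := Aᶜ) hA.not).not
    · exact hA
  · rintro (_ | _)
    · exact (interior_self_sdiff_interior _)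
    · exact hi

theorem isNowhereDense_self_sdiff_interior (hfield : ExpandsOrderedField L)
    (hlom : LocallyOMinimal L) {d : ℕ} {A : Set (Fin d → ℝ)} (hA : DefPred L fun x => x ∈ A) :
    IsNowhereDense (A \ interior A) :=
  hlom.isNowhereDense hfield (hA.and (DefPred.mem_interior hfield hA).not)
    (interior_self_sdiff_interior _)

theorem dense_interior_of_dense (hfield : ExpandsOrderedField L)
    (hlom : LocallyOMinimal L) {d : ℕ} {A : Set (Fin d → ℝ)} (hA : DefPred L fun x => x ∈ A)
    (hd : Dense A) : Dense (interior A) := by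
  have := hlom.isNowhereDense hfield (A := Aᶜ) hA.not (interior_eq_empty_iff_dense_compl.2
    (by rwa [compl_compl]))
  rw [IsNowhereDense, closure_compl, interior_eq_empty_iff_dense_compl, compl_compl] at this
  exact this

end Thin

section Smoothness

theorem MonotoneOn.exists_differentiableAt_Ioo {f : ℝ → ℝ} {a b : ℝ} (hab : a < b)
    (hf : MonotoneOn f (Set.Ioo a b)) : ∃ t ∈ Set.Ioo a b, DifferentiableAt ℝ f t := by
  by_contra! h
  have h0 : ∀ᵐ x, x ∉ Set.Ioo a b := by
    filter_upwards [hf.ae_differentiableWithinAt_of_mem] with x hx hx'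
    exact h x hx' ((hx hx').differentiableAt (Ioo_mem_nhds hx'.1 hx'.2))
  rw [← MeasureTheory.measure_eq_zero_iff_ae_notMem, Real.volume_Ioo, ENNReal.ofReal_eq_zero] at h0
  linarith

theorem DefFn.exists_differentiableAt (hfield : ExpandsOrderedField L) (hlom : LocallyOMinimal L)
    {f : ℝ → ℝ} (hf : DefFn L f) {a b : ℝ} (hab : a < b) :
    ∃ t ∈ Set.Ioo a b, DifferentiableAt ℝ f t := by
  let s : ℕ × Bool → Set ℝ := fun k => {x | (a < x ∧ x < b) ∧ ∀ y, x < y → y < x + 1 / (k.1 + 1) →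
    cond k.2 (f x ≤ f y) (f y ≤ f x)}
  have hs : ∀ k, DefPred L fun x => x ∈ s k := by
    rintro ⟨n, k⟩
    refine (((DefFn.const a).lt hfield DefFn.id).and (DefFn.id.lt hfield (DefFn.const b))).and
      (DefPred.all (p := fun x y => x < y → y < x + 1 / ((n : ℝ) + 1) →
        cond k (f x ≤ f y) (f y ≤ f x)) ((DefFn.id.fst.lt hfield DefFn.id.snd).imp
        ((DefFn.id.snd.lt hfield (DefFn.id.fst.add hfield (DefFn.const _))).imp ?_)))
    cases k
    · exact (hf.comp DefFn.id.snd).le hfield (hf.comp DefFn.id.fst)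
    · exact (hf.comp DefFn.id.fst).le hfield (hf.comp DefFn.id.snd)
  have hcover : Set.Ioo a b ⊆ ⋃ k, s k := by
    intro x hx
    have key : ∃ k : Bool, ∀ᶠ y in 𝓝[>] x, cond k (f x ≤ f y) (f y ≤ f x) := by
      rcases hlom.eventually_nhdsGT (p := fun y => f x ≤ f y)
        ((DefFn.const (f x)).le hfield hf) x with h | h
      · exact ⟨true, h⟩
      · exact ⟨false, h.mono fun y hy => (not_le.1 hy).le⟩
    obtain ⟨k, hk⟩ := key
    obtain ⟨c, hc, hk⟩ := mem_nhdsGT_iff_exists_Ioo_subset.1 hk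
    obtain ⟨n, hn⟩ := exists_nat_one_div_lt (K := ℝ) (sub_pos.2 (Set.mem_Ioi.1 hc))
    exact Set.mem_iUnion.2 ⟨(n, k), hx, fun y h1 h2 => hk ⟨h1, by simp only at h2; linarith⟩⟩
  have : ∃ k, interior (s k) ≠ ∅ := by
    by_contra! h
    exact hlom.not_Ioo_subset_iUnion hs h hab hcover
  obtain ⟨⟨n, k⟩, hk⟩ := this
  obtain ⟨q, r, hqr, h⟩ := exists_rat_Ioo_subset (Set.nonempty_iff_ne_empty.2 hk)
  have hqr' : (q : ℝ) < r := by exact_mod_cast hqr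
  have hn : (0 : ℝ) < 1 / ((n : ℝ) + 1) := Nat.one_div_pos_of_nat
  set e : ℝ := min r (q + 1 / ((n : ℝ) + 1)) with he
  have hqe : (q : ℝ) < e := lt_min hqr' (by linarith)
  have hsub : Set.Ioo (q : ℝ) e ⊆ Set.Ioo (q : ℝ) r := Set.Ioo_subset_Ioo_right (min_le_left _ _)
  have hle : ∀ x ∈ Set.Ioo (q : ℝ) e, ∀ y ∈ Set.Ioo (q : ℝ) e, x < y →
      cond k (f x ≤ f y) (f y ≤ f x) := fun x hx y hy hxy =>
    (h (hsub hx)).2 y hxy (by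
      have := hy.2.trans_le (min_le_right _ _)
      have := hx.1
      simp only
      linarith)
  have hab' : Set.Ioo (q : ℝ) e ⊆ Set.Ioo a b := fun x hx => (h (hsub hx)).1
  cases k
  · obtain ⟨t, ht, hd⟩ := MonotoneOn.exists_differentiableAt_Ioo (f := -f) hqe
      fun x hx y hy hxy => by
        rcases hxy.eq_or_lt with rfl | hxy
        · rfl
        · exact neg_le_neg (hle x hx y hy hxy)
    exact ⟨t, hab' ht, by simpa using hd.neg⟩
  · obtain ⟨t, ht, hd⟩ := MonotoneOn.exists_differentiableAt_Ioo (f := f) hqe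
      fun x hx y hy hxy => by
        rcases hxy.eq_or_lt with rfl | hxy
        · rfl
        · exact hle x hx y hy hxy
    exact ⟨t, hab' ht, hd⟩

theorem DefFn.dense_differentiableAt_update (hfield : ExpandsOrderedField L)
    (hlom : LocallyOMinimal L) {d : ℕ} {f : (Fin d → ℝ) → ℝ} (hf : DefFn L f) (i : Fin d) :
    Dense {x : Fin d → ℝ | DifferentiableAt ℝ (fun t => f (Function.update x i t)) (x i)} := by
  refine dense_iff_inter_open.2 fun U hU ⟨x, hx⟩ => ?_
  have hc : Continuous fun t : ℝ => Function.update x i t := by fun_prop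
  have : ∀ᶠ t in 𝓝 (x i), Function.update x i t ∈ U :=
    hc.continuousAt.eventually_mem (by simpa using hU.mem_nhds hx)
  obtain ⟨a, b, hab, h⟩ := mem_nhds_iff_exists_Ioo_subset.1 this
  obtain ⟨t, ht, hd⟩ := DefFn.exists_differentiableAt hfield hlom
    (hf.comp ((DefFn.const x).update i DefFn.id)) (hab.1.trans hab.2)
  exact ⟨Function.update x i t, h ht, by simpa using hd⟩

theorem DefFn.dense_continuousAt (hfield : ExpandsOrderedField L)
    (hlom : LocallyOMinimal L) {d : ℕ} {f : (Fin d → ℝ) → ℝ} (hf : DefFn L f) :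
    Dense {x | ContinuousAt f x} := by
  let A : ℚ × ℚ → Set (Fin d → ℝ) := fun q => {x | (q.1 : ℝ) < f x ∧ f x < q.2}
  have hA : ∀ q, DefPred L fun x => x ∈ A q := fun q =>
    ((DefFn.const _).lt hfield hf).and (hf.lt hfield (DefFn.const _))
  have hm : IsMeagre (⋃ q, A q \ interior (A q)) :=
    isMeagre_iUnion fun q => (isNowhereDense_self_sdiff_interior hfield hlom (hA q)).isMeagre
  refine (dense_of_mem_residual hm).mono fun x hx => ?_
  rw [Set.mem_ofPred_eq, ContinuousAt, tendsto_order]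
  simp only [Set.compl_iUnion, Set.mem_iInter, Set.mem_compl_iff, Set.mem_sdiff, not_and,
    not_not] at hx
  have key : ∀ a b, a < f x → f x < b → ∀ᶠ y in 𝓝 x, a < f y ∧ f y < b := by
    intro a b ha hb
    obtain ⟨q, hq, hq'⟩ := exists_rat_btwn ha
    obtain ⟨r, hr, hr'⟩ := exists_rat_btwn hb
    filter_upwards [mem_interior_iff_mem_nhds.1 (hx (q, r) ⟨hq', hr⟩)] with y hy
    exact ⟨hq.trans hy.1, hy.2.trans hr'⟩
  exact ⟨fun a ha => (key a _ ha (lt_add_one _)).mono fun _ h => h.1,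
    fun b hb => (key _ b (sub_one_lt _) hb).mono fun _ h => h.2⟩

theorem hasFDerivAt_of_partialDeriv {κ : Type} [Fintype κ] [DecidableEq κ] {f : (κ → ℝ) → ℝ}
    {u : κ → ℝ}
    (hd : ∀ᶠ x in 𝓝 u, ∀ i, DifferentiableAt ℝ (fun t => f (Function.update x i t)) (x i))
    (hc : ∀ i, ContinuousAt (partialDeriv f i) u) :
    HasFDerivAt f (∑ i, partialDeriv f i u • (ContinuousLinearMap.proj i : (κ → ℝ) →L[ℝ] ℝ)) u := by
  rw [hasFDerivAt_iff_isLittleO, Asymptotics.isLittleO_iff]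
  intro c hc0
  set ε : ℝ := c / (Fintype.card κ + 1) with hε
  have hε0 : 0 < ε := by positivity
  have hc' : ∀ᶠ x in 𝓝 u, ∀ i, |partialDeriv f i x - partialDeriv f i u| < ε := by
    rw [Filter.eventually_all]
    intro i
    simpa [Real.dist_eq] using Metric.tendsto_nhds.1 (hc i) ε hε0
  obtain ⟨δ, hδ, hball⟩ := Metric.eventually_nhds_iff_ball.1 (hd.and hc')
  filter_upwards [Metric.ball_mem_nhds u hδ] with y hy
  have hmem : ∀ z : κ → ℝ, (∀ i, |z i - u i| ≤ |y i - u i|) → z ∈ Metric.ball u δ := by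
    intro z hz
    rw [Metric.mem_ball, dist_pi_lt_iff hδ] at hy ⊢
    exact fun i => (hz i).trans_lt (hy i)
  have step : ∀ S : Finset κ, |f (S.piecewise y u) - f u -
      ∑ i ∈ S, partialDeriv f i u * (y i - u i)| ≤ ∑ i ∈ S, ε * |y i - u i| := by
    intro S
    induction S using Finset.induction_on with
    | empty => simp
    | insert j S hj ih =>
      rw [Finset.sum_insert hj, Finset.sum_insert hj, Finset.piecewise_insert]
      set x := S.piecewise y u with hx
      have hxj : x j = u j := by simp [hx, hj]
      have hxu : Function.update x j (u j) = x := by rw [← hxj, Function.update_eq_self]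
      let φ : ℝ → ℝ := fun t => f (Function.update x j t) - t * partialDeriv f j u
      have hφ : ∀ t ∈ Set.uIcc (u j) (y j), HasDerivWithinAt φ
          (partialDeriv f j (Function.update x j t) - partialDeriv f j u)
          (Set.uIcc (u j) (y j)) t ∧
          ‖partialDeriv f j (Function.update x j t) - partialDeriv f j u‖ ≤ ε := by
        intro t ht
        have hb := hball (Function.update x j t) (hmem _ fun i => by
          by_cases hi : i = j
          · subst hi
            simpa using Set.abs_sub_left_of_mem_uIcc ht
          · rw [Function.update_of_ne hi]
            by_cases hiS : i ∈ S <;> simp [hx, hiS])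
        refine ⟨?_, (hb.2 j).le⟩
        have h1 := (hb.1 j).hasDerivAt
        simp only [Function.update_self, Function.update_idem] at h1
        have h2 : partialDeriv f j (Function.update x j t) =
            deriv (fun t => f (Function.update x j t)) t := by
          simp [partialDeriv]
        rw [h2]
        refine (h1.sub ?_).hasDerivWithinAt
        simpa using (hasDerivAt_id t).mul_const (partialDeriv f j u)
      have hmv := (convex_uIcc (u j) (y j)).norm_image_sub_le_of_norm_hasDerivWithin_le
        (fun t ht => (hφ t ht).1) (fun t ht => (hφ t ht).2) Set.left_mem_uIcc Set.right_mem_uIcc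
      simp only [Real.norm_eq_abs, φ, hxu] at hmv
      calc _ = |(f (Function.update x j (y j)) - y j * partialDeriv f j u -
              (f x - u j * partialDeriv f j u)) +
              (f x - f u - ∑ i ∈ S, partialDeriv f i u * (y i - u i))| := by congr 1; ring
        _ ≤ _ := (abs_add_le _ _).trans (add_le_add hmv ih)
  have := step Finset.univ
  simp only [Finset.piecewise_univ] at this
  have hsum : ∑ i, ε * |y i - u i| ≤ c * ‖y - u‖ := by
    calc ∑ i, ε * |y i - u i| ≤ ∑ _i : κ, ε * ‖y - u‖ := by
          gcongr with i
          exact norm_le_pi_norm (y - u) i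
      _ = (Fintype.card κ * ε) * ‖y - u‖ := by simp [mul_assoc]
      _ ≤ _ := by
          gcongr
          rw [hε]
          field_simp
          linarith
  simpa using this.trans hsum

theorem DefFn.dense_contDiffAt (hfield : ExpandsOrderedField L)
    (hlom : LocallyOMinimal L) {d : ℕ} (r : ℕ) : ∀ {f : (Fin d → ℝ) → ℝ}, DefFn L f →
    Dense {x | ContDiffAt ℝ r f x} := by
  induction r with
  | zero =>
    intro f hf
    refine (dense_interior_of_dense hfield hlom (hf.defPred_continuousAt hfield)
      (hf.dense_continuousAt hfield hlom)).mono fun x hx => ?_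
    exact contDiffAt_zero.2 ⟨_, mem_interior_iff_mem_nhds.1 hx,
      fun y hy => ContinuousAt.continuousWithinAt hy⟩
  | succ r ih =>
    intro f hf
    have hopen : ∀ i, IsOpen {x | ContDiffAt ℝ r (Paper.partialDeriv f i) x} := fun i =>
      isOpen_iff_mem_nhds.2 fun x hx => ContDiffAt.eventually hx (by simp)
    have h1 : Dense (⋂ i, interior
        {x : Fin d → ℝ | DifferentiableAt ℝ (fun t => f (Function.update x i t)) (x i)}) :=
      dense_iInter_of_isOpen (fun _ => isOpen_interior) fun i => dense_interior_of_dense hfield hlom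
        (hf.defPred_differentiableAt_update hfield i)
        (hf.dense_differentiableAt_update hfield hlom i)
    have h2 : Dense (⋂ i, {x | ContDiffAt ℝ r (Paper.partialDeriv f i) x}) :=
      dense_iInter_of_isOpen hopen fun i => ih (hf.partialDeriv hfield i)
    have ho1 : IsOpen (⋂ i, interior
        {x : Fin d → ℝ | DifferentiableAt ℝ (fun t => f (Function.update x i t)) (x i)}) :=
      isOpen_iInter_of_finite fun _ => isOpen_interior
    have ho2 : IsOpen (⋂ i, {x | ContDiffAt ℝ r (Paper.partialDeriv f i) x}) :=
      isOpen_iInter_of_finite hopen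
    refine (h1.inter_of_isOpen_left h2 ho1).mono fun x hx => ?_
    push_cast
    refine contDiffAt_succ_iff_hasFDerivAt.2
      ⟨fun y => ∑ i, Paper.partialDeriv f i y • (ContinuousLinearMap.proj i : (Fin d → ℝ) →L[ℝ] ℝ),
        ⟨_, (ho1.inter ho2).mem_nhds hx, fun y hy => ?_⟩, ?_⟩
    · refine hasFDerivAt_of_partialDeriv ?_ fun i => ?_
      · filter_upwards [ho1.mem_nhds hy.1] with z hz i
        have hzi := interior_subset (Set.mem_iInter.1 hz i)
        exact hzi
      · have hyi : ContDiffAt ℝ r (Paper.partialDeriv f i) y := Set.mem_iInter.1 hy.2 i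
        exact hyi.continuousAt
    · refine ContDiffAt.sum fun i _ => ?_
      have hxi : ContDiffAt ℝ r (Paper.partialDeriv f i) x := Set.mem_iInter.1 hx.2 i
      exact hxi.smul contDiffAt_const

end Smoothness

section Dimension

theorem HasDim.exists_of_nonempty {n : ℕ} {X : Set (Fin n → ℝ)} (hX : X.Nonempty) :
    ∃ d, HasDim X d := by
  classical
  let p : ℕ → Prop := fun d => ∃ σ : Fin d → Fin n, Function.Injective σ ∧
    (interior (coordProj d σ '' X)).Nonempty
  have hle : ∀ d, p d → d ≤ n := fun d ⟨σ, hσ, _⟩ => by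
    simpa using Fintype.card_le_of_injective σ hσ
  have h0 : p 0 := by
    refine ⟨Fin.elim0, fun i => i.elim0, ?_⟩
    rw [interior_eq_iff_isOpen.2 (isOpen_discrete _)]
    exact hX.image _
  exact ⟨Nat.findGreatest p n, Nat.findGreatest_spec (Nat.zero_le _) h0,
    fun e σ hσ h => Nat.le_findGreatest (hle e ⟨σ, hσ, h⟩) ⟨σ, hσ, h⟩⟩

theorem DefFn.coordProj {n d : ℕ} {E : Type} [Coord E] {g : E → Fin n → ℝ} (hg : DefFn L g)
    (σ : Fin d → Fin n) : DefFn L fun x => coordProj d σ (g x) :=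
  DefFn.pi fun i => hg.eval (σ i)

theorem contDiff_coordProj {n d : ℕ} (σ : Fin d → Fin n) {r : WithTop ℕ∞} :
    ContDiff ℝ r (coordProj d σ) :=
  contDiff_pi.2 fun i => contDiff_apply ℝ ℝ (σ i)

theorem DefFunOn.defPred_graph {n : ℕ} {X : Set (Fin n → ℝ)} {f : (Fin n → ℝ) → ℝ}
    (hf : DefFunOn L n X f) : DefPred L fun p : (Fin n → ℝ) × ℝ => p.1 ∈ X ∧ p.2 = f p.1 := by
  have h : DefPred L fun z : Fin (n + 1) → ℝ =>
    fstFun z ∈ X ∧ sndFun z = fun _ => f (fstFun z) := hf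
  refine (h.comp (g := fun p : (Fin n → ℝ) × ℝ => Fin.append p.1 fun _ : Fin 1 => p.2)
    (DefFn.pi fun k => ?_)).congr fun p => ?_
  · refine Fin.addCases (fun i => ?_) (fun i => ?_) k
    · simpa using DefFn.id.fst.eval i
    · simpa using DefFn.id.snd
  · have h1 : fstFun (Fin.append p.1 fun _ : Fin 1 => p.2) = p.1 := by
      ext i
      simp [fstFun]
    have h2 : sndFun (Fin.append p.1 fun _ : Fin 1 => p.2) = fun _ => p.2 := by
      ext i
      simp [sndFun]
    rw [h1, h2]
    simp [funext_iff]

/-- If no coordinate projection of `X` to `ℝ^(d+1)` has interior, the fibers of a coordinate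
projection to `ℝ^d` are generically thin in every coordinate. -/
theorem isMeagre_setOf_fiber_interior_nonempty (hfield : ExpandsOrderedField L)
    (hlom : LocallyOMinimal L) {n d : ℕ} {X : Set (Fin n → ℝ)} (hX : DefPred L fun x => x ∈ X)
    (hd : ∀ σ : Fin (d + 1) → Fin n, Function.Injective σ →
      interior (coordProj (d + 1) σ '' X) = ∅)
    {σ : Fin d → Fin n} (hσ : Function.Injective σ) (j : Fin n) :
    IsMeagre {t : Fin d → ℝ |
      (interior {s : ℝ | ∃ x ∈ X, coordProj d σ x = t ∧ x j = s}).Nonempty} := by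
  let B : {q : ℚ × ℚ // q.1 < q.2} → Set (Fin d → ℝ) := fun q =>
    {t | ∀ s : ℝ, (q.1.1 : ℝ) < s → s < q.1.2 → ∃ x ∈ X, coordProj d σ x = t ∧ x j = s}
  have hB : ∀ q, DefPred L fun t => t ∈ B q := fun q =>
    DefPred.all (p := fun (t : Fin d → ℝ) (s : ℝ) => (q.1.1 : ℝ) < s → s < q.1.2 →
      ∃ x ∈ X, coordProj d σ x = t ∧ x j = s)
      (((DefFn.const _).lt hfield DefFn.id.snd).imp ((DefFn.id.snd.lt hfield (DefFn.const _)).imp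
        (DefPred.ex (p := fun (z : (Fin d → ℝ) × ℝ) x => x ∈ X ∧ coordProj d σ x = z.1 ∧ x j = z.2)
          ((hX.comp DefFn.id.snd).and (((DefFn.id.snd.coordProj σ).eq DefFn.id.fst.fst).and
            ((DefFn.id.snd.eval j).eq DefFn.id.fst.snd))))))
  have hBi : ∀ q, interior (B q) = ∅ := by
    intro q
    have hq : (q.1.1 : ℝ) < q.1.2 := by exact_mod_cast q.2
    by_contra hne
    replace hne := Set.nonempty_iff_ne_empty.2 hne
    by_cases hj : j ∈ Set.range σ
    · obtain ⟨k, rfl⟩ := hj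
      obtain ⟨t, ht⟩ := hne
      obtain ⟨s, h1, h2⟩ := exists_between hq
      obtain ⟨s', h3, h4⟩ := exists_between h1
      obtain ⟨x, -, hx, rfl⟩ := interior_subset ht s h1 h2
      obtain ⟨x', -, hx', rfl⟩ := interior_subset ht s' h3 (h4.trans h2)
      exact h4.ne (congrFun (hx'.trans hx.symm) k)
    · refine (interior_nonempty_of_fibers
        (A := coordProj (d + 1) (Fin.cons j σ : Fin (d + 1) → Fin n) '' X) hne hq
        fun t ht s h1 h2 => ?_).ne_empty (hd _ (Fin.cons_injective_iff.2 ⟨hj, hσ⟩))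
      obtain ⟨x, hx, rfl, rfl⟩ := ht s h1 h2
      refine ⟨x, hx, funext fun k => Fin.cases ?_ (fun k => ?_) k⟩ <;> simp [coordProj]
  refine (isMeagre_iUnion fun q => (hlom.isNowhereDense hfield (hB q) (hBi q)).isMeagre).mono
    fun t ht => ?_
  obtain ⟨q, r, hqr, h⟩ := exists_rat_Ioo_subset ht
  exact Set.mem_iUnion.2 ⟨⟨(q, r), hqr⟩, fun s h1 h2 => h ⟨h1, h2⟩⟩

theorem LocallyOMinimal.exists_rat_isolating (hlom : LocallyOMinimal L) {s : Set ℝ}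
    (hs : DefPred L fun x => x ∈ s) (hi : interior s = ∅) (a : ℝ) :
    ∃ q : ℚ × ℚ, (q.1 < a ∧ a < q.2) ∧ ∀ x ∈ s, q.1 < x → x < q.2 → x = a := by
  obtain ⟨b, c, hb, hc, hfin⟩ := hlom.finite_inter_Ioo hs hi a
  have : Set.Ioo b c ∩ ((s ∩ Set.Ioo b c) \ {a})ᶜ ∈ 𝓝 a :=
    Filter.inter_mem (Ioo_mem_nhds hb hc)
      ((hfin.subset Set.sdiff_subset).isClosed.isOpen_compl.mem_nhds (by simp))
  obtain ⟨b', c', hbc, h⟩ := mem_nhds_iff_exists_Ioo_subset.1 this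
  obtain ⟨q, hq, hq'⟩ := exists_rat_btwn hbc.1
  obtain ⟨r, hr, hr'⟩ := exists_rat_btwn hbc.2
  refine ⟨(q, r), ⟨hq', hr⟩, fun x hx h1 h2 => ?_⟩
  have := h ⟨hq.trans h1, h2.trans hr'⟩
  by_contra hne
  exact this.2 ⟨⟨hx, this.1⟩, hne⟩

/-- For a definable function on `X`, the coordinate projections to `ℝ^d`, with `d` at least the
dimension of `X`, send the set of points where the function is not `C^r` to a set with empty
interior. -/
theorem interior_coordProj_image_not_contDiff (hfield : ExpandsOrderedField L)
    (hlom : LocallyOMinimal L) (r : ℕ) {n d : ℕ} {X : Set (Fin n → ℝ)} (hXdef : Def L n X)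
    {f : (Fin n → ℝ) → ℝ} (hf : DefFunOn L n X f)
    (hd : ∀ σ : Fin (d + 1) → Fin n, Function.Injective σ →
      interior (coordProj (d + 1) σ '' X) = ∅)
    {σ : Fin d → Fin n} (hσ : Function.Injective σ) :
    interior (coordProj d σ '' {x ∈ X | ¬ ∃ (W : Set (Fin n → ℝ)) (g : (Fin n → ℝ) → ℝ),
      x ∈ W ∧ IsOpen W ∧ ContDiffOn ℝ r g W ∧ Set.EqOn f g (X ∩ W)}) = ∅ := by
  classical
  have hX : DefPred L fun x => x ∈ X := hXdef
  let Q : (Fin n → ℚ × ℚ) → Set (Fin n → ℝ) := fun q => {x | ∀ i, (q i).1 < x i ∧ x i < (q i).2}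
  let R : (Fin n → ℚ × ℚ) → (Fin d → ℝ) → (Fin n → ℝ) → Prop := fun q t x =>
    x ∈ X ∧ x ∈ Q q ∧ coordProj d σ x = t
  let S : (Fin n → ℚ × ℚ) → Set (Fin d → ℝ) := fun q => {t | ∃! x, R q t x}
  have hQ : ∀ q, DefPred L fun x => x ∈ Q q := fun q => DefPred.allFin fun i =>
    ((DefFn.const _).lt hfield (DefFn.id.eval i)).and ((DefFn.id.eval i).lt hfield (DefFn.const _))
  have hR : ∀ q, DefPred L fun z : (Fin d → ℝ) × (Fin n → ℝ) => R q z.1 z.2 := fun q =>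
    (hX.comp DefFn.id.snd).and (((hQ q).comp DefFn.id.snd).and
      ((DefFn.id.snd.coordProj σ).eq DefFn.id.fst))
  have hS : ∀ q, DefPred L fun t => t ∈ S q := fun q =>
    DefPred.ex (p := fun t x => R q t x ∧ ∀ x', R q t x' → x' = x) ((hR q).and
      (DefPred.all (p := fun (z : (Fin d → ℝ) × (Fin n → ℝ)) x' => R q z.1 x' → x' = z.2)
        (((hR q).comp (DefFn.id.fst.fst.pair DefFn.id.snd)).imp
          (DefFn.id.snd.eq DefFn.id.fst.snd))))
  let h : (Fin n → ℚ × ℚ) → (Fin d → ℝ) → ℝ := fun q t =>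
    if ht : t ∈ S q then f ht.choose else 0
  have hh : ∀ q t x, t ∈ S q → R q t x → h q t = f x := by
    intro q t x ht hx
    simp only [h, dif_pos ht]
    rw [ht.choose_spec.2 x hx]
  have hhdef : ∀ q, DefFn L (h q) := by
    intro q
    refine ((((hS q).comp DefFn.id.fst).and
      (DefPred.ex (p := fun (z : (Fin d → ℝ) × ℝ) x => R q z.1 x ∧ (x ∈ X ∧ z.2 = f x))
      (((hR q).comp (DefFn.id.fst.fst.pair DefFn.id.snd)).and
        (hf.defPred_graph.comp (DefFn.id.snd.pair DefFn.id.fst.snd))))).or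
      (((hS q).comp DefFn.id.fst).not.and
        (DefFn.id.snd.eq (DefFn.const (0 : ℝ))))).congr fun z => ?_
    by_cases hz : z.1 ∈ S q
    · simp only [hz, true_and, not_true_eq_false, false_and, or_false]
      constructor
      · intro hz2
        obtain ⟨x, hx, -⟩ := id hz
        exact ⟨x, hx, hx.1, hz2.trans (hh q _ x hz hx)⟩
      · rintro ⟨x, hx, -, hz2⟩
        exact hz2.trans (hh q _ x hz hx).symm
    · simp [hz, h]
  let C : (Fin n → ℚ × ℚ) → Set (Fin d → ℝ) := fun q => {t | ContDiffAt ℝ r (h q) t}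
  have hCo : ∀ q, IsOpen (C q) := fun q =>
    isOpen_iff_mem_nhds.2 fun x hx => ContDiffAt.eventually hx (by simp)
  have hbad : IsMeagre (⋃ q, S q \ interior (S q) ∪ (C q)ᶜ) := by
    refine isMeagre_iUnion fun q => IsMeagre.union
      (isNowhereDense_self_sdiff_interior hfield hlom (hS q)).isMeagre ?_
    rw [IsMeagre, compl_compl]
    exact residual_of_dense_open (hCo q) ((hhdef q).dense_contDiffAt hfield hlom r)
  have hthin := isMeagre_iUnion
    (isMeagre_setOf_fiber_interior_nonempty hfield hlom hX hd hσ)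
  by_contra hne
  have hmain := not_isMeagre_of_isOpen isOpen_interior (Set.nonempty_iff_ne_empty.2 hne)
  obtain ⟨t, ht, htbad⟩ : ∃ t ∈ interior (coordProj d σ '' {x ∈ X |
      ¬ ∃ (W : Set (Fin n → ℝ)) (g : (Fin n → ℝ) → ℝ), x ∈ W ∧ IsOpen W ∧ ContDiffOn ℝ r g W ∧
        Set.EqOn f g (X ∩ W)}), t ∉ (⋃ q, S q \ interior (S q) ∪ (C q)ᶜ) ∪
      ⋃ j, {t : Fin d → ℝ |
        (interior {s : ℝ | ∃ x ∈ X, coordProj d σ x = t ∧ x j = s}).Nonempty} := by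
    by_contra hcon
    exact hmain ((hbad.union hthin).mono fun t ht => by_contra fun htn => hcon ⟨t, ht, htn⟩)
  obtain ⟨x, ⟨hxX, hx⟩, hxt⟩ := interior_subset ht
  have hiso : ∀ j, ∃ q : ℚ × ℚ, (q.1 < x j ∧ x j < q.2) ∧
      ∀ s ∈ {s : ℝ | ∃ x ∈ X, coordProj d σ x = t ∧ x j = s}, q.1 < s → s < q.2 → s = x j := by
    intro j
    refine hlom.exists_rat_isolating ?_ ?_ (x j)
    · exact DefPred.ex (p := fun (s : ℝ) x => x ∈ X ∧ coordProj d σ x = t ∧ x j = s)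
        ((hX.comp DefFn.id.snd).and (((DefFn.id.snd.coordProj σ).eq (DefFn.const t)).and
          ((DefFn.id.snd.eval j).eq DefFn.id.fst)))
    · rw [← Set.not_nonempty_iff_eq_empty]
      exact fun hj => htbad (Or.inr (Set.mem_iUnion.2 ⟨j, hj⟩))
  choose q hqx hq using hiso
  have htS : t ∈ S q := ⟨x, ⟨hxX, hqx, hxt⟩, fun x' hx' => funext fun j =>
    hq j (x' j) ⟨x', hx'.1, hx'.2.2, rfl⟩ (hx'.2.1 j).1 (hx'.2.1 j).2⟩
  have htq : t ∈ interior (S q) ∩ C q := by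
    have hnot : ¬ t ∈ S q \ interior (S q) ∪ (C q)ᶜ := fun h' =>
      htbad (Or.inl (Set.mem_iUnion.2 ⟨q, h'⟩))
    constructor <;> by_contra h'
    · exact hnot (Or.inl ⟨htS, h'⟩)
    · exact hnot (Or.inr h')
  have hπ : Continuous (coordProj d σ : (Fin n → ℝ) → _) :=
    (contDiff_coordProj σ (r := 0)).continuous
  have hQo : IsOpen (Q q) := by
    have : Q q = Set.pi Set.univ fun i => Set.Ioo ((q i).1 : ℝ) (q i).2 := by
      ext
      simp [Q]
    rw [this]
    exact isOpen_set_pi Set.finite_univ fun i _ => isOpen_Ioo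
  refine hx ⟨Q q ∩ coordProj d σ ⁻¹' (interior (S q) ∩ C q), h q ∘ coordProj d σ,
    ⟨hqx, by rwa [Set.mem_preimage, hxt]⟩,
    hQo.inter ((isOpen_interior.inter (hCo q)).preimage hπ), fun y hy => ?_, fun y hy => ?_⟩
  · have hy' : ContDiffAt ℝ r (h q) (coordProj d σ y) := hy.2.2
    exact (hy'.comp y (contDiff_coordProj σ).contDiffAt).contDiffWithinAt
  · exact (hh q _ y (interior_subset hy.2.2.1) ⟨hy.1, hy.2.1, rfl⟩).symm

end Dimension

variable (L)

/-- the set of points where a definable function fails to be of class `C^r`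
has dimension smaller than the dimension of the domain. -/
theorem statement14
    (hfield : ExpandsOrderedField L) (hlom : LocallyOMinimal L)
    (r : ℕ) (hr : 1 ≤ r) (n : ℕ)
    (X : Set (Fin n → ℝ)) (hXdef : Def L n X) (hXne : X.Nonempty)
    (f : (Fin n → ℝ) → ℝ) (hf : DefFunOn L n X f)
    (D : Set (Fin n → ℝ))
    (hD : D = {x ∈ X | ¬ ∃ (W : Set (Fin n → ℝ)) (g : (Fin n → ℝ) → ℝ),
      x ∈ W ∧ IsOpen W ∧ ContDiffOn ℝ r g W ∧ Set.EqOn f g (X ∩ W)}) :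
    ∃ dX : ℕ, HasDim X dX ∧ (D = ∅ ∨ ∃ dD : ℕ, HasDim D dD ∧ dD < dX) := by
  obtain ⟨dX, hdX⟩ := HasDim.exists_of_nonempty hXne
  refine ⟨dX, hdX, ?_⟩
  rcases D.eq_empty_or_nonempty with hDe | hDne
  · exact Or.inl hDe
  · obtain ⟨dD, hdD⟩ := HasDim.exists_of_nonempty hDne
    refine Or.inr ⟨dD, hdD, ?_⟩
    by_contra hle
    obtain ⟨σ, hσ, hne⟩ := hdD.1
    refine hne.ne_empty ?_
    rw [hD]
    refine interior_coordProj_image_not_contDiff hfield hlom r hXdef hf (fun τ hτ => ?_) hσ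
    by_contra h
    have := hdX.2 _ τ hτ (Set.nonempty_iff_ne_empty.2 h)
    omega

end Paper
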